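/- Let (k,X,Ω,A,K) be an instance of weight-constrained anisotropic clustering, ε ∈ (0,1/2], δ ∈ [1,∞), let (X̃,Ω̃) be an (ε/3,δ)-coreset for it with extension f, let C̃ ∈ C_K(k,X̃,Ω̃), and let γ ∈ ℝ with γ ≥ δ. If C̃ is a γ-approximation for the clustering instance (k,X̃,Ω̃,A,K), i.e. cost_{A,K}(X̃,C̃) ≤ γ·OPT_{A,K}(X̃), then f(C̃) is a (1+ε)γ-approximation for (k,X,Ω,A,K), i.e. cost_{A,K}(X,f(C̃)) ≤ (1+ε)γ·OPT_{A,K}(X). -/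

import Mathlib

open Finset Matrix

noncomputable section

/-- Squared anisotropic (ellipsoidal) norm `‖v‖_A² = vᵀ A v`. -/
def anormSq {d : ℕ} (A : Matrix (Fin d) (Fin d) ℝ) (v : Fin d → ℝ) : ℝ :=
  v ⬝ᵥ A.mulVec v

/-- `ξ` is a (fractional) `k`-clustering of `n` points. -/
def IsClustering {k n : ℕ} (ξ : Fin k → Fin n → ℝ) : Prop :=
  (∀ i j, 0 ≤ ξ i j) ∧ ∀ j, ∑ i, ξ i j = 1

/-- The weight `ω(C_i)` of the `i`-th cluster. -/
def clusterWeight {k n : ℕ} (ω : Fin n → ℝ) (ξ : Fin k → Fin n → ℝ) (i : Fin k) : ℝ :=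
  ∑ j, ξ i j * ω j

/-- `ξ` is a weight-constrained `k`-clustering (an element of `C_K(k,X,Ω)`). -/
def IsWCC {k n : ℕ} (κlo κhi : Fin k → ℝ) (ω : Fin n → ℝ) (ξ : Fin k → Fin n → ℝ) : Prop :=
  IsClustering ξ ∧ ∀ i, κlo i ≤ clusterWeight ω ξ i ∧ clusterWeight ω ξ i ≤ κhi i

/-- `cost_{A,K}(X,C,S)`. -/
def cost {d k n : ℕ} (A : Fin k → Matrix (Fin d) (Fin d) ℝ)
    (x : Fin n → Fin d → ℝ) (ω : Fin n → ℝ) (ξ : Fin k → Fin n → ℝ)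
    (s : Fin k → Fin d → ℝ) : ℝ :=
  ∑ i, ∑ j, ξ i j * ω j * anormSq (A i) (x j - s i)

/-- `cost_{A,K}(X,S)`: optimal constrained assignment cost for fixed sites `s`. -/
def assignCost {d k n : ℕ} (κlo κhi : Fin k → ℝ) (A : Fin k → Matrix (Fin d) (Fin d) ℝ)
    (x : Fin n → Fin d → ℝ) (ω : Fin n → ℝ) (s : Fin k → Fin d → ℝ) : ℝ :=
  sInf {c : ℝ | ∃ ξ, IsWCC κlo κhi ω ξ ∧ c = cost A x ω ξ s}

/-- `cost_{A,K}(X,C)`: infimum over site tuples. -/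
def clusterCost {d k n : ℕ} (A : Fin k → Matrix (Fin d) (Fin d) ℝ)
    (x : Fin n → Fin d → ℝ) (ω : Fin n → ℝ) (ξ : Fin k → Fin n → ℝ) : ℝ :=
  sInf {c : ℝ | ∃ s : Fin k → Fin d → ℝ, c = cost A x ω ξ s}

/-- `OPT_{A,K}(X)`. -/
def OPTc {d k n : ℕ} (κlo κhi : Fin k → ℝ) (A : Fin k → Matrix (Fin d) (Fin d) ℝ)
    (x : Fin n → Fin d → ℝ) (ω : Fin n → ℝ) : ℝ :=
  sInf {c : ℝ | ∃ ξ, IsWCC κlo κhi ω ξ ∧ c = clusterCost A x ω ξ}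

/-- Unconstrained optimum `OPT_A(X)` (over all clusterings and all site tuples). -/
def OPTu {d k n : ℕ} (A : Fin k → Matrix (Fin d) (Fin d) ℝ)
    (x : Fin n → Fin d → ℝ) (ω : Fin n → ℝ) : ℝ :=
  sInf {c : ℝ | ∃ ξ, ∃ s : Fin k → Fin d → ℝ, IsClustering ξ ∧ c = cost A x ω ξ s}

/-- `(X',Ω')` is an `(ε,δ)`-coreset for `(k,X,Ω,A,K)`, witnessed by the extension `f`
and the offsets `Δp`, `Δm`. -/
def IsCoresetWith {d k n m : ℕ} (ε δ : ℝ) (κlo κhi : Fin k → ℝ)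
    (A : Fin k → Matrix (Fin d) (Fin d) ℝ)
    (x : Fin n → Fin d → ℝ) (ω : Fin n → ℝ)
    (x' : Fin m → Fin d → ℝ) (ω' : Fin m → ℝ)
    (f : (Fin k → Fin m → ℝ) → (Fin k → Fin n → ℝ)) (Δp Δm : ℝ) : Prop :=
  0 ≤ Δp ∧ Δp ≤ δ * Δm ∧
  (∀ ξ', IsWCC κlo κhi ω' ξ' → IsWCC κlo κhi ω (f ξ')) ∧
  ∀ (s : Fin k → Fin d → ℝ) (ξ' : Fin k → Fin m → ℝ), IsWCC κlo κhi ω' ξ' →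
    (1 - ε) * cost A x ω (f ξ') s ≤ cost A x' ω' ξ' s + Δp ∧
    assignCost κlo κhi A x' ω' s + Δm ≤ (1 + ε) * assignCost κlo κhi A x ω s


theorem anormSq_nonneg {d : ℕ} {A : Matrix (Fin d) (Fin d) ℝ} (hA : A.PosDef)
    (v : Fin d → ℝ) : 0 ≤ anormSq A v := by
  simpa [anormSq] using hA.posSemidef.dotProduct_mulVec_nonneg v

section Cost

variable {d k n : ℕ} {κlo κhi : Fin k → ℝ} {A : Fin k → Matrix (Fin d) (Fin d) ℝ}
  {x : Fin n → Fin d → ℝ} {ω : Fin n → ℝ} {ξ : Fin k → Fin n → ℝ}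

theorem cost_nonneg (hA : ∀ i, (A i).PosDef) (hω : ∀ j, 0 < ω j) (hξ : IsClustering ξ)
    (s : Fin k → Fin d → ℝ) : 0 ≤ cost A x ω ξ s :=
  Finset.sum_nonneg fun i _ => Finset.sum_nonneg fun j _ =>
    mul_nonneg (mul_nonneg (hξ.1 i j) (hω j).le) (anormSq_nonneg (hA i) _)

theorem clusterCost_le_cost (hA : ∀ i, (A i).PosDef) (hω : ∀ j, 0 < ω j)
    (hξ : IsClustering ξ) (s : Fin k → Fin d → ℝ) : clusterCost A x ω ξ ≤ cost A x ω ξ s := by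
  refine csInf_le ⟨0, ?_⟩ ⟨s, rfl⟩
  rintro _ ⟨t, rfl⟩
  exact cost_nonneg hA hω hξ t

theorem le_clusterCost {a : ℝ} (h : ∀ s, a ≤ cost A x ω ξ s) : a ≤ clusterCost A x ω ξ := by
  refine le_csInf ⟨_, 0, rfl⟩ ?_
  rintro _ ⟨s, rfl⟩
  exact h s

theorem assignCost_le_cost (hA : ∀ i, (A i).PosDef) (hω : ∀ j, 0 < ω j)
    (hξ : IsWCC κlo κhi ω ξ) (s : Fin k → Fin d → ℝ) :
    assignCost κlo κhi A x ω s ≤ cost A x ω ξ s := by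
  refine csInf_le ⟨0, ?_⟩ ⟨ξ, hξ, rfl⟩
  rintro _ ⟨ζ, hζ, rfl⟩
  exact cost_nonneg hA hω hζ.1 s

theorem OPTc_le_clusterCost (hA : ∀ i, (A i).PosDef) (hω : ∀ j, 0 < ω j)
    (hξ : IsWCC κlo κhi ω ξ) : OPTc κlo κhi A x ω ≤ clusterCost A x ω ξ := by
  refine csInf_le ⟨0, ?_⟩ ⟨ξ, hξ, rfl⟩
  rintro _ ⟨ζ, hζ, rfl⟩
  exact le_clusterCost (cost_nonneg hA hω hζ.1)

theorem le_OPTc (hne : ∃ ξ, IsWCC κlo κhi ω ξ) {a : ℝ}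
    (h : ∀ ξ, IsWCC κlo κhi ω ξ → ∀ s, a ≤ cost A x ω ξ s) : a ≤ OPTc κlo κhi A x ω := by
  obtain ⟨ζ, hζ⟩ := hne
  refine le_csInf ⟨_, ζ, hζ, rfl⟩ ?_
  rintro _ ⟨ξ, hξ, rfl⟩
  exact le_clusterCost (h ξ hξ)

theorem OPTc_le_assignCost (hA : ∀ i, (A i).PosDef) (hω : ∀ j, 0 < ω j)
    (hne : ∃ ξ, IsWCC κlo κhi ω ξ) (s : Fin k → Fin d → ℝ) :
    OPTc κlo κhi A x ω ≤ assignCost κlo κhi A x ω s := by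
  obtain ⟨ζ, hζ⟩ := hne
  refine le_csInf ⟨_, ζ, hζ, rfl⟩ ?_
  rintro _ ⟨ξ, hξ, rfl⟩
  exact (OPTc_le_clusterCost hA hω hξ).trans (clusterCost_le_cost hA hω hξ.1 s)

end Cost

theorem statement5 {d k n m : ℕ} (ε δ : ℝ) (hε : 0 < ε ∧ ε ≤ 1 / 2) (hδ : 1 ≤ δ)
    (κlo κhi : Fin k → ℝ) (hκ : ∀ i, κlo i ≤ κhi i)
    (A : Fin k → Matrix (Fin d) (Fin d) ℝ) (hA : ∀ i, (A i).PosDef)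
    (x : Fin n → Fin d → ℝ) (ω : Fin n → ℝ) (hω : ∀ j, 0 < ω j)
    (x' : Fin m → Fin d → ℝ) (ω' : Fin m → ℝ) (hω' : ∀ j, 0 < ω' j)
    (hne : ∃ ξ, IsWCC κlo κhi ω ξ) (hne' : ∃ ξ', IsWCC κlo κhi ω' ξ')
    (f : (Fin k → Fin m → ℝ) → (Fin k → Fin n → ℝ)) (Δp Δm : ℝ)
    (hcs : IsCoresetWith (ε / 3) δ κlo κhi A x ω x' ω' f Δp Δm)
    (ξ' : Fin k → Fin m → ℝ) (hξ' : IsWCC κlo κhi ω' ξ')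
    (γ : ℝ) (hγ : δ ≤ γ)
    (happrox : clusterCost A x' ω' ξ' ≤ γ * OPTc κlo κhi A x' ω') :
    clusterCost A x ω (f ξ') ≤ (1 + ε) * γ * OPTc κlo κhi A x ω := by
  obtain ⟨hε0, hε1⟩ := hε
  obtain ⟨hΔp, hΔ, hf, hcs⟩ := hcs
  have hΔm : 0 ≤ Δm := nonneg_of_mul_nonneg_right (hΔp.trans hΔ) (by linarith)
  have hupper : (1 - ε / 3) * clusterCost A x ω (f ξ') - Δp ≤ clusterCost A x' ω' ξ' := by
    refine le_clusterCost fun s => ?_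
    have h := mul_le_mul_of_nonneg_left
      (clusterCost_le_cost (x := x) hA hω (hf ξ' hξ').1 s) (by linarith : 0 ≤ 1 - ε / 3)
    linarith [(hcs s ξ' hξ').1]
  have hlower : (OPTc κlo κhi A x' ω' + Δm) / (1 + ε / 3) ≤ OPTc κlo κhi A x ω := by
    refine le_OPTc hne fun ξ hξ s => ?_
    rw [div_le_iff₀' (by linarith)]
    have h := mul_le_mul_of_nonneg_left
      (assignCost_le_cost (x := x) hA hω hξ s) (by linarith : 0 ≤ 1 + ε / 3)
    linarith [(hcs s ξ' hξ').2, OPTc_le_assignCost (x := x') hA hω' hne' s]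
  rw [div_le_iff₀' (by linarith)] at hlower
  have hopt : 0 ≤ OPTc κlo κhi A x ω := le_OPTc hne fun ξ hξ => cost_nonneg hA hω hξ.1
  have hγ0 : 0 ≤ γ := by linarith
  have hfactor : 1 + ε / 3 ≤ (1 - ε / 3) * (1 + ε) := by nlinarith
  refine le_of_mul_le_mul_left ?_ (by linarith : 0 < 1 - ε / 3)
  calc (1 - ε / 3) * clusterCost A x ω (f ξ')
      ≤ γ * OPTc κlo κhi A x' ω' + γ * Δm := by
        linarith [mul_le_mul_of_nonneg_right hγ hΔm]
    _ = γ * (OPTc κlo κhi A x' ω' + Δm) := by ring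
    _ ≤ γ * ((1 + ε / 3) * OPTc κlo κhi A x ω) := by gcongr
    _ ≤ γ * ((1 - ε / 3) * (1 + ε) * OPTc κlo κhi A x ω) := by gcongr
    _ = (1 - ε / 3) * ((1 + ε) * γ * OPTc κlo κhi A x ω) := by ring

end
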